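/- Let (R,m) be a noetherian local ring and M a G-perfect R-module of grade g whose minimal free resolution is eventually periodic with period a > 0. Set N = Ext^g_R(M,R). Then (Ω^i_R N)* ≈ Ω^{g+ma−i}_R M (stable isomorphism, up to free summands) for all integers i ≥ g and m ≥ i/a. -/

import Mathlib

open CategoryTheory IsLocalRing

noncomputable def ExtMod (R : Type) [CommRing R] (M N : Type) [AddCommGroup M] [Module R M]
    [AddCommGroup N] [Module R N] (i : ℕ) : ModuleCat R :=
  ((Ext R (ModuleCat.{0} R) i).obj (Opposite.op (ModuleCat.of R M))).obj (ModuleCat.of R N)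

noncomputable def mgrade (R : Type) [CommRing R] (M : Type) [AddCommGroup M] [Module R M] : ℕ :=
  sInf {i | Nontrivial (ExtMod R M R i)}

def IsTotallySelfDual (R : Type) [CommRing R] (M : Type) [AddCommGroup M] [Module R M] : Prop :=
  Nontrivial M ∧ Nonempty (ExtMod R M R (mgrade R M) ≃ₗ[R] M) ∧
    ∀ i, i ≠ mgrade R M → Subsingleton (ExtMod R M R i)

/-- A minimal free resolution of `M` over a local ring `R`: a resolution by finite free
modules all of whose differentials (and the augmentation) have image inside `𝔪`-times
the target (resp. have kernel inside `𝔪 F₀`). -/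
structure MinFreeRes (R : Type) [CommRing R] [IsLocalRing R]
    (M : Type) [AddCommGroup M] [Module R M] where
  F : ℕ → ModuleCat.{0} R
  free : ∀ n, Module.Free R (F n)
  fin : ∀ n, Module.Finite R (F n)
  d : ∀ n, F (n + 1) →ₗ[R] F n
  aug : F 0 →ₗ[R] M
  aug_surj : Function.Surjective aug
  exact_aug : LinearMap.ker aug = LinearMap.range (d 0)
  exact : ∀ n, LinearMap.ker (d n) = LinearMap.range (d (n + 1))
  minimal : ∀ n, LinearMap.range (d n) ≤ (maximalIdeal R) • (⊤ : Submodule R (F n))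

namespace MinFreeRes

variable {R : Type} [CommRing R] [IsLocalRing R]
  {M : Type} [AddCommGroup M] [Module R M]

/-- The `n`-th syzygy of `M` with respect to a minimal free resolution:
`Ω⁰ M = M` and `Ωⁿ⁺¹ M = Im(dₙ) = Ker(dₙ₋₁)`. -/
noncomputable def Syz (C : MinFreeRes R M) : ℕ → ModuleCat.{0} R
  | 0 => ModuleCat.of R M
  | n + 1 => ModuleCat.of R (LinearMap.range (C.d n))

/-- A minimal free resolution is self-dual if it is bounded, of length `r`, and is
isomorphic (as a complex) to its `R`-dual complex with reversed indexing. -/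
def SelfDual (C : MinFreeRes R M) : Prop :=
  ∃ r : ℕ, (∀ n, r < n → Subsingleton (C.F n)) ∧ Nontrivial (C.F r) ∧
    ∃ e : ∀ ⦃m n : ℕ⦄, m + n = r → (C.F n ≃ₗ[R] Module.Dual R (C.F m)),
      ∀ (q n : ℕ) (hp : (q + 1) + n = r) (hq : q + (n + 1) = r),
        (e hp).toLinearMap ∘ₗ C.d n = (C.d q).dualMap ∘ₗ (e hq).toLinearMap

/-- A minimal free resolution is eventually periodic with period `a` if
`Ωⁿ M ≅ Ωⁿ⁺ᵃ M` for some `n`. -/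
def EventuallyPeriodic (C : MinFreeRes R M) (a : ℕ) : Prop :=
  0 < a ∧ ∃ n : ℕ, Nonempty (C.Syz n ≃ₗ[R] C.Syz (n + a))

end MinFreeRes

/-- Stable isomorphism: `X ⊕ P ≅ Y ⊕ Q` for some finite free `P`, `Q`. -/
def StablyIso (R : Type) [CommRing R] (X Y : Type) [AddCommGroup X] [Module R X]
    [AddCommGroup Y] [Module R Y] : Prop :=
  ∃ (P Q : ModuleCat.{0} R), Module.Free R P ∧ Module.Finite R P ∧
    Module.Free R Q ∧ Module.Finite R Q ∧ Nonempty ((X × P) ≃ₗ[R] (Y × Q))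

/-- A finitely generated module is totally reflexive if it is reflexive and
`Ext^i_R(M,R) = Ext^i_R(M*,R) = 0` for all `i > 0`. -/
def IsTotallyReflexive (R : Type) [CommRing R] (M : Type) [AddCommGroup M] [Module R M] : Prop :=
  Module.Finite R M ∧ Function.Bijective (Module.Dual.eval R M) ∧
  (∀ i : ℕ, 0 < i → Subsingleton (ExtMod R M R i)) ∧
  (∀ i : ℕ, 0 < i → Subsingleton (ExtMod R (Module.Dual R M) R i))

/-- `GdimLE R n M` : `M` admits a resolution of length at most `n`
by totally reflexive modules. -/
def GdimLE (R : Type) [CommRing R] : ℕ → ModuleCat.{0} R → Prop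
  | 0, M => IsTotallyReflexive R M
  | n+1, M => IsTotallyReflexive R M ∨ ∃ (G : ModuleCat.{0} R) (f : G →ₗ[R] M),
      IsTotallyReflexive R G ∧ Function.Surjective f ∧
      GdimLE R n (ModuleCat.of R (LinearMap.ker f))

/-- The Gorenstein dimension of `M`. -/
noncomputable def Gdim (R : Type) [CommRing R] (M : Type) [AddCommGroup M] [Module R M] : ℕ∞ :=
  sInf {n : ℕ∞ | ∃ m : ℕ, n = (m : ℕ∞) ∧ GdimLE R m (ModuleCat.of R M)}

/-- `M` is G-perfect if it is nonzero and its Gorenstein dimension equals its grade. -/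
def IsGPerfect (R : Type) [CommRing R] (M : Type) [AddCommGroup M] [Module R M] : Prop :=
  Nontrivial M ∧ Gdim R M = (mgrade R M : ℕ∞)

theorem ext_subsingleton_iff_abelianExt {R : Type} [CommRing R] (M N : Type) [AddCommGroup M]
    [Module R M] [AddCommGroup N] [Module R N] (n : ℕ) :
    Subsingleton (ExtMod R M N (n + 1)) ↔
      Subsingleton (Abelian.Ext (ModuleCat.of R M) (ModuleCat.of R N) (n + 1)) := by
  let P := ProjectiveResolution.of (ModuleCat.of R M)
  let Y := ModuleCat.of R N
  have h1 : Subsingleton (ExtMod R M N (n + 1)) ↔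
      ∀ f : P.complex.X (n + 1) ⟶ Y, P.complex.d (n + 2) (n + 1) ≫ f = 0 →
        ∃ g : P.complex.X n ⟶ Y, P.complex.d (n + 1) n ≫ g = f := by
    rw [← ModuleCat.isZero_iff_subsingleton,
      Iso.isZero_iff (show ExtMod R M N (n + 1) ≅ _ from P.isoExt (n + 1) Y),
      ← HomologicalComplex.exactAt_iff_isZero_homology,
      HomologicalComplex.exactAt_iff' _ n (n + 1) (n + 2) (by simp) (by simp),
      ShortComplex.moduleCat_exact_iff]
    rfl
  rw [h1]
  constructor
  · refine fun h => ⟨fun a b => ?_⟩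
    suffices ∀ a : Abelian.Ext (ModuleCat.of R M) Y (n + 1), a = 0 from
      (this a).trans (this b).symm
    intro a
    obtain ⟨f, hf, rfl⟩ := P.extMk_surjective a (n + 2) rfl
    exact (P.extMk_eq_zero_iff f (n + 2) rfl hf n rfl).2 (h f hf)
  · intro h f hf
    exact (P.extMk_eq_zero_iff f (n + 2) rfl hf n rfl).1 (Subsingleton.elim _ _)

theorem subsingleton_ext_of_gdimLE {R : Type} [CommRing R] (n : ℕ) (M : ModuleCat.{0} R)
    (h : GdimLE R n M) (i : ℕ) (hi : n < i) : Subsingleton (ExtMod R M R i) := by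
  induction n generalizing M i with
  | zero => exact h.2.2.1 i hi
  | succ n ih =>
    rcases h with h | ⟨G, f, hG, hf, hK⟩
    · exact h.2.2.1 i (by omega)
    · obtain ⟨i, rfl⟩ : ∃ j, i = j + 2 := ⟨i - 2, by omega⟩
      have hK := (ext_subsingleton_iff_abelianExt _ _ _).1 (ih _ hK (i + 1) (by omega))
      have hG := (ext_subsingleton_iff_abelianExt _ _ _).1 (hG.2.2.1 (i + 2) (by omega))
      refine (ext_subsingleton_iff_abelianExt _ _ _).2 ⟨fun a b => ?_⟩
      have hS := LinearMap.shortExact_shortComplexKer hf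
      suffices ∀ a : Abelian.Ext (ModuleCat.of R M) (ModuleCat.of R R) (i + 2), a = 0 from
        (this a).trans (this b).symm
      intro a
      obtain ⟨b, rfl⟩ := Abelian.Ext.contravariant_sequence_exact₃ hS (ModuleCat.of R R) a
        (hG.elim _ _) (n₀ := i + 1) (by omega)
      rw [hK.elim b 0]
      simp

theorem exists_ker_to_homology {R : Type} [CommRing R] (S : ShortComplex (ModuleCat.{0} R)) :
    ∃ q : LinearMap.ker S.g.hom →ₗ[R] S.homology, Function.Surjective q ∧
      ∀ x, q x = 0 ↔ ∃ y, S.f.hom y = (x : S.X₂) := by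
  let e : (LinearMap.ker S.g.hom ⧸ LinearMap.range S.moduleCatToCycles) ≃ₗ[R] S.homology :=
    S.moduleCatHomologyIso.symm.toLinearEquiv
  refine ⟨e.toLinearMap ∘ₗ (LinearMap.range S.moduleCatToCycles).mkQ,
    e.surjective.comp (Submodule.mkQ_surjective _), fun x => ?_⟩
  rw [LinearMap.comp_apply, LinearEquiv.coe_coe, LinearEquiv.map_eq_zero_iff,
    Submodule.mkQ_apply, Submodule.Quotient.mk_eq_zero, LinearMap.mem_range]
  exact exists_congr fun y => Subtype.ext_iff

namespace MinFreeRes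

variable {R : Type} [CommRing R] [IsLocalRing R] {M : Type} [AddCommGroup M] [Module R M]

/-- The underlying chain complex of a minimal free resolution. -/
noncomputable def chainComplex (C : MinFreeRes R M) : ChainComplex (ModuleCat.{0} R) ℕ :=
  ChainComplex.of C.F (fun n => ModuleCat.ofHom (C.d n)) fun n => by
    ext x
    have : C.d (n + 1) x ∈ LinearMap.ker (C.d n) := by rw [C.exact]; exact ⟨x, rfl⟩
    exact this

theorem chainComplex_d (C : MinFreeRes R M) (n : ℕ) :
    C.chainComplex.d (n + 1) n = ModuleCat.ofHom (C.d n) :=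
  ChainComplex.of_d C.F (fun n => ModuleCat.ofHom (C.d n)) n

/-- The augmentation of a minimal free resolution, as a morphism of complexes. -/
noncomputable def augmentation (C : MinFreeRes R M) :
    C.chainComplex ⟶ (ChainComplex.single₀ _).obj (ModuleCat.of R M) :=
  (ChainComplex.toSingle₀Equiv _ _).symm ⟨ModuleCat.ofHom C.aug, by
    rw [chainComplex_d]
    ext x
    have : C.d 0 x ∈ LinearMap.ker C.aug := by rw [C.exact_aug]; exact ⟨x, rfl⟩
    exact this⟩

theorem augmentation_f_zero (C : MinFreeRes R M) : C.augmentation.f 0 = ModuleCat.ofHom C.aug :=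
  ChainComplex.toSingle₀Equiv_symm_apply_f_zero ..

/-- A minimal free resolution, viewed as a projective resolution. -/
noncomputable def projectiveResolution (C : MinFreeRes R M) :
    ProjectiveResolution (ModuleCat.of R M) where
  complex := C.chainComplex
  projective n := by
    have := C.free n
    exact ModuleCat.projective_of_free (Module.Free.chooseBasis R (C.F n))
  π := C.augmentation
  quasiIso := ⟨fun n => by
    cases n
    · rw [ChainComplex.quasiIsoAt₀_iff, ShortComplex.quasiIso_iff_of_zeros']
      · refine ⟨?_, ?_⟩
        · rw [ShortComplex.moduleCat_exact_iff]
          intro (x : C.F 0) hx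
          have hx : x ∈ LinearMap.ker C.aug := congr($(C.augmentation_f_zero).hom x).symm.trans hx
          rw [C.exact_aug] at hx
          obtain ⟨y, rfl⟩ := hx
          exact ⟨y, congr($(C.chainComplex_d 0).hom y)⟩
        · rw [ModuleCat.epi_iff_surjective]
          intro y
          obtain ⟨x, hx⟩ := C.aug_surj y
          exact ⟨x, congr($(C.augmentation_f_zero).hom x).trans hx⟩
      all_goals rfl
    · rw [quasiIsoAt_iff_exactAt' _ _ (ChainComplex.exactAt_succ_single_obj ..),
        HomologicalComplex.exactAt_iff' _ _ _ _ (by simp; rfl) (by simp; rfl),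
        ShortComplex.moduleCat_exact_iff]
      rename_i n
      intro (x : C.F (n + 1)) hx
      have hx : x ∈ LinearMap.ker (C.d n) := congr($(C.chainComplex_d n).hom x).symm.trans hx
      rw [C.exact] at hx
      obtain ⟨y, rfl⟩ := hx
      exact ⟨y, congr($(C.chainComplex_d (n + 1)).hom y)⟩⟩

/-- The coboundaries of the dual of a minimal free resolution. -/
noncomputable def coboundaries (C : MinFreeRes R M) : ∀ n, Submodule R (Module.Dual R (C.F n))
  | 0 => ⊥
  | n + 1 => LinearMap.range (C.d n).dualMap

/-- The cocycles of the dual of a minimal free resolution. -/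
noncomputable abbrev cocycles (C : MinFreeRes R M) (n : ℕ) :
    Submodule R (Module.Dual R (C.F n)) :=
  LinearMap.ker (C.d n).dualMap

theorem exists_cocycles_to_ext (C : MinFreeRes R M) (n : ℕ) :
    ∃ q : C.cocycles n →ₗ[R] ExtMod R M R n, Function.Surjective q ∧
      ∀ x, q x = 0 ↔ (x : Module.Dual R (C.F n)) ∈ C.coboundaries n := by
  let P := C.projectiveResolution
  let K := P.complex.linearYonedaObj R (ModuleCat.of R R)
  let e : ExtMod R M R n ≅ K.homology n := P.isoExt n (ModuleCat.of R R)
  have hd (n : ℕ) (y : C.F n →ₗ[R] R) :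
      (K.d n (n + 1)).hom (ModuleCat.ofHom y) = ModuleCat.ofHom (y ∘ₗ C.d n) :=
    congr($(C.chainComplex_d n) ≫ ModuleCat.ofHom y)
  obtain ⟨i, hi, hf⟩ : ∃ i, (ComplexShape.up ℕ).prev n = i ∧ ∀ x : Module.Dual R (C.F n),
      (∃ y, (K.d i n).hom y = ModuleCat.ofHom x) ↔ x ∈ C.coboundaries n := by
    cases n with
    | zero =>
      refine ⟨0, by simp, fun x => ?_⟩
      rw [K.shape 0 0 (by simp)]
      exact ⟨fun ⟨_, hy⟩ => congr(ModuleCat.Hom.hom $hy).symm,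
        fun hx => ⟨0, congr(ModuleCat.ofHom $hx).symm⟩⟩
    | succ n =>
      exact ⟨n, by simp, fun x =>
        ⟨fun ⟨y, hy⟩ => ⟨ModuleCat.Hom.hom y, congr(ModuleCat.Hom.hom $((hd n _).symm.trans hy))⟩,
        fun ⟨y, hy⟩ => ⟨ModuleCat.ofHom y, (hd n y).trans congr(ModuleCat.ofHom $hy)⟩⟩⟩
  obtain ⟨q, hq, hq'⟩ : ∃ q : LinearMap.ker (K.d n (n + 1)).hom →ₗ[R] (K.sc' i n (n + 1)).homology,
      Function.Surjective q ∧ ∀ x, q x = 0 ↔ ∃ y, (K.d i n).hom y = (x : K.X n) :=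
    exists_ker_to_homology (K.sc' i n (n + 1))
  let e' : (K.sc' i n (n + 1)).homology ≅ ExtMod R M R n :=
    (K.homologyIsoSc' i n (n + 1) hi (by simp)).symm ≪≫ e.symm
  let h : Module.Dual R (C.F n) ≃ₗ[R] K.X n :=
    (ModuleCat.homLinearEquiv (S := R) (M := C.F n) (N := ModuleCat.of R R)).symm
  have hker : (C.cocycles n).map h.toLinearMap = LinearMap.ker (K.d n (n + 1)).hom := by
    ext y
    obtain ⟨x, rfl⟩ := h.surjective y
    refine (Submodule.mem_map_equiv (e := h) _).trans ?_
    rw [h.symm_apply_apply]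
    exact ⟨fun hx => (hd n x).trans congr(ModuleCat.ofHom $hx),
      fun hx => congr(ModuleCat.Hom.hom $((hd n x).symm.trans hx))⟩
  let l := h.submoduleMap (C.cocycles n) ≪≫ₗ LinearEquiv.ofEq _ _ hker
  refine ⟨e'.toLinearEquiv.toLinearMap ∘ₗ q ∘ₗ l.toLinearMap,
    e'.toLinearEquiv.surjective.comp (hq.comp l.surjective), fun x => ?_⟩
  exact e'.toLinearEquiv.map_eq_zero_iff.trans ((hq' (l x)).trans (hf x))

end MinFreeRes

section StableModules

variable {R : Type} [CommRing R]
  {X : Type} [AddCommGroup X] [Module R X] {X' : Type} [AddCommGroup X'] [Module R X']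
  {Y : Type} [AddCommGroup Y] [Module R Y] {Y' : Type} [AddCommGroup Y'] [Module R Y']
  {Z : Type} [AddCommGroup Z] [Module R Z] {Z' : Type} [AddCommGroup Z'] [Module R Z']

theorem nonempty_linearEquiv_of_range_eq {f : X →ₗ[R] Z} {g : Y →ₗ[R] Z}
    (hf : Function.Injective f) (hg : Function.Injective g)
    (h : LinearMap.range f = LinearMap.range g) : Nonempty (X ≃ₗ[R] Y) :=
  ⟨LinearEquiv.ofInjective f hf ≪≫ₗ LinearEquiv.ofEq _ _ h ≪≫ₗ (LinearEquiv.ofInjective g hg).symm⟩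

theorem nonempty_linearEquiv_of_ker_eq {f : Z →ₗ[R] X} {g : Z →ₗ[R] Y}
    (hf : Function.Surjective f) (hg : Function.Surjective g)
    (h : LinearMap.ker f = LinearMap.ker g) : Nonempty (X ≃ₗ[R] Y) :=
  ⟨(f.quotKerEquivOfSurjective hf).symm ≪≫ₗ Submodule.quotEquivOfEq _ _ h ≪≫ₗ
    g.quotKerEquivOfSurjective hg⟩

namespace StablyIso

theorem of_linearEquiv (e : X ≃ₗ[R] Y) : StablyIso R X Y :=
  ⟨ModuleCat.of R PUnit, ModuleCat.of R PUnit, inferInstanceAs (Module.Free R PUnit),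
    inferInstanceAs (Module.Finite R PUnit), inferInstanceAs (Module.Free R PUnit),
    inferInstanceAs (Module.Finite R PUnit), ⟨e.prodCongr (LinearEquiv.refl R PUnit)⟩⟩

theorem symm (h : StablyIso R X Y) : StablyIso R Y X := by
  obtain ⟨P, Q, h1, h2, h3, h4, ⟨e⟩⟩ := h
  exact ⟨Q, P, h3, h4, h1, h2, ⟨e.symm⟩⟩

theorem trans (h : StablyIso R X Y) (h' : StablyIso R Y Z) : StablyIso R X Z := by
  obtain ⟨P, Q, _, _, _, _, ⟨e⟩⟩ := h
  obtain ⟨P', Q', _, _, _, _, ⟨e'⟩⟩ := h'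
  refine ⟨ModuleCat.of R (P × P'), ModuleCat.of R (Q' × Q),
    inferInstanceAs (Module.Free R (P × P')), inferInstanceAs (Module.Finite R (P × P')),
    inferInstanceAs (Module.Free R (Q' × Q)), inferInstanceAs (Module.Finite R (Q' × Q)), ⟨?_⟩⟩
  exact (LinearEquiv.prodAssoc R X P P').symm ≪≫ₗ e.prodCongr (LinearEquiv.refl R P') ≪≫ₗ
    LinearEquiv.prodAssoc R Y Q P' ≪≫ₗ
    (LinearEquiv.refl R Y).prodCongr (LinearEquiv.prodComm R Q P') ≪≫ₗ
    (LinearEquiv.prodAssoc R Y P' Q).symm ≪≫ₗ e'.prodCongr (LinearEquiv.refl R Q) ≪≫ₗ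
    LinearEquiv.prodAssoc R Z Q' Q

theorem dual (h : StablyIso R X Y) : StablyIso R (Module.Dual R X) (Module.Dual R Y) := by
  obtain ⟨P, Q, _, _, _, _, ⟨e⟩⟩ := h
  exact ⟨ModuleCat.of R (Module.Dual R P), ModuleCat.of R (Module.Dual R Q),
    inferInstanceAs (Module.Free R (Module.Dual R P)),
    inferInstanceAs (Module.Finite R (Module.Dual R P)),
    inferInstanceAs (Module.Free R (Module.Dual R Q)),
    inferInstanceAs (Module.Finite R (Module.Dual R Q)),
    ⟨Module.dualProdDualEquivDual R X P ≪≫ₗ e.symm.dualMap ≪≫ₗ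
      (Module.dualProdDualEquivDual R Y Q).symm⟩⟩

theorem isReflexive (h : StablyIso R X Y) [Module.IsReflexive R Y] : Module.IsReflexive R X := by
  obtain ⟨P, Q, _, _, _, _, ⟨e⟩⟩ := h
  have := Module.equiv e.symm
  exact Module.IsReflexive.of_split (LinearMap.inl R X P) (LinearMap.fst R X P) (by ext; rfl)

end StablyIso

variable (R) in
/-- `X` is a first syzygy of `Y`, with respect to some finite free module mapping onto `Y`. -/
def IsSyzygy (X Y : Type) [AddCommGroup X] [Module R X] [AddCommGroup Y] [Module R Y] : Prop :=
  ∃ (P : ModuleCat.{0} R) (i : X →ₗ[R] P) (p : P →ₗ[R] Y), Module.Free R P ∧ Module.Finite R P ∧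
    Function.Injective i ∧ Function.Surjective p ∧ LinearMap.range i = LinearMap.ker p

variable (R) in
/-- `X` is a first syzygy of `Y` by a sequence whose dual is exact, i.e. `Ext¹(Y, R) = 0`. -/
def IsDualExactSyzygy (X Y : Type) [AddCommGroup X] [Module R X] [AddCommGroup Y] [Module R Y] :
    Prop :=
  ∃ (P : ModuleCat.{0} R) (i : X →ₗ[R] P) (p : P →ₗ[R] Y), Module.Free R P ∧ Module.Finite R P ∧
    Function.Injective i ∧ Function.Surjective p ∧ LinearMap.range i = LinearMap.ker p ∧
    Function.Surjective i.dualMap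

theorem IsDualExactSyzygy.isSyzygy (h : IsDualExactSyzygy R X Y) : IsSyzygy R X Y := by
  obtain ⟨P, i, p, h1, h2, h3, h4, h5, -⟩ := h
  exact ⟨P, i, p, h1, h2, h3, h4, h5⟩

theorem IsSyzygy.prod_right (h : IsSyzygy R X Y) (Q : Type) [AddCommGroup Q] [Module R Q]
    [Module.Free R Q] [Module.Finite R Q] : IsSyzygy R X (Y × Q) := by
  obtain ⟨P, i, p, _, _, hi, hp, h⟩ := h
  refine ⟨ModuleCat.of R (P × Q), LinearMap.inl R P Q ∘ₗ i, p.prodMap LinearMap.id,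
    inferInstanceAs (Module.Free R (P × Q)), inferInstanceAs (Module.Finite R (P × Q)),
    LinearMap.inl_injective.comp hi, hp.prodMap Function.surjective_id, ?_⟩
  rw [LinearMap.range_comp, h]
  ext ⟨x, y⟩
  simp [eq_comm]

theorem IsDualExactSyzygy.prod_left (h : IsDualExactSyzygy R X Y) (Q : Type) [AddCommGroup Q]
    [Module R Q] [Module.Free R Q] [Module.Finite R Q] : IsDualExactSyzygy R (X × Q) Y := by
  obtain ⟨P, i, p, _, _, hi, hp, h, hd⟩ := h
  refine ⟨ModuleCat.of R (P × Q), i.prodMap LinearMap.id, p ∘ₗ LinearMap.fst R P Q,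
    inferInstanceAs (Module.Free R (P × Q)), inferInstanceAs (Module.Finite R (P × Q)),
    hi.prodMap Function.injective_id, hp.comp Prod.fst_surjective, ?_, fun f => ?_⟩
  · rw [LinearMap.ker_comp, ← h]
    ext ⟨x, y⟩
    simp
  · obtain ⟨g, hg⟩ := hd (f ∘ₗ LinearMap.inl R X Q)
    refine ⟨g.coprod (f ∘ₗ LinearMap.inr R X Q), ?_⟩
    ext x
    · have : g (i x) = f (x, 0) := LinearMap.congr_fun hg x
      simp [this, Prod.mk_zero_zero]
    · simp

/-- Schanuel's lemma. -/
theorem IsSyzygy.stablyIso_of_linearEquiv (h : IsSyzygy R X Y) (h' : IsSyzygy R X' Y')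
    (e : Y ≃ₗ[R] Y') : StablyIso R X X' := by
  obtain ⟨P, i, p, _, _, hi, hp, h⟩ := h
  obtain ⟨P', i', p', _, _, hi', hp', h'⟩ := h'
  obtain ⟨s, hs⟩ := Module.projective_lifting_property p (e.symm.toLinearMap ∘ₗ p') hp
  obtain ⟨t, ht⟩ := Module.projective_lifting_property p' (e.toLinearMap ∘ₗ p) hp'
  have hs (x) : e (p (s x)) = p' x := by simpa using congr(e ($hs x))
  have ht (x) : p' (t x) = e (p x) := LinearMap.congr_fun ht x
  have h (x) : (∃ y, i y = x) ↔ p x = 0 := by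
    rw [← LinearMap.mem_range, h, LinearMap.mem_ker]
  have h' (x) : (∃ y, i' y = x) ↔ p' x = 0 := by
    rw [← LinearMap.mem_range, h', LinearMap.mem_ker]
  refine ⟨P', P, ‹_›, ‹_›, ‹_›, ‹_›, nonempty_linearEquiv_of_range_eq
    (f := (i.coprod s).prod (LinearMap.snd R X P'))
    (g := (LinearMap.snd R X' P).prod (i'.coprod t)) ?_ ?_ ?_⟩
  · rintro ⟨x, y⟩ ⟨x', y'⟩ hxy
    obtain ⟨h1, h2⟩ := Prod.ext_iff.1 hxy
    obtain rfl : y = y' := h2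
    simpa using hi (by simpa using h1)
  · rintro ⟨x, y⟩ ⟨x', y'⟩ hxy
    obtain ⟨h1, h2⟩ := Prod.ext_iff.1 hxy
    obtain rfl : y = y' := h1
    simpa using hi' (by simpa using h2)
  · trans LinearMap.ker ((e.toLinearMap ∘ₗ p).coprod (-p'))
    · ext ⟨x, y⟩
      have := h (x - s y)
      rw [← e.map_eq_zero_iff, map_sub, map_sub, hs, sub_eq_zero] at this
      simp [← sub_eq_add_neg, sub_eq_zero, ← this, eq_sub_iff_add_eq]
    · ext ⟨x, y⟩
      have := h' (y - t x)
      simp only [map_sub, sub_eq_zero, ht] at this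
      simp [← sub_eq_add_neg, sub_eq_zero, eq_comm (b := p' y), ← this, Prod.ext_iff,
        eq_sub_iff_add_eq]

theorem IsSyzygy.stablyIso (h : IsSyzygy R X Y) (h' : IsSyzygy R X' Y')
    (e : StablyIso R Y Y') : StablyIso R X X' := by
  obtain ⟨P, Q, _, _, _, _, ⟨e⟩⟩ := e
  exact (h.prod_right P).stablyIso_of_linearEquiv (h'.prod_right Q) e

theorem exists_extension_of_surjective_dualMap {P : Type} [AddCommGroup P] [Module R P]
    [Module.Free R P] [Module.Finite R P] {i : X →ₗ[R] Y} (hi : Function.Surjective i.dualMap)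
    (f : X →ₗ[R] P) : ∃ g : Y →ₗ[R] P, ∀ x, g (i x) = f x := by
  let b := (Module.Free.chooseBasis R P).equivFun
  choose g hg using fun j => hi (LinearMap.proj j ∘ₗ b.toLinearMap ∘ₗ f)
  refine ⟨b.symm.toLinearMap ∘ₗ LinearMap.pi g, fun x => b.injective ?_⟩
  ext j
  simpa using LinearMap.congr_fun (hg j) x

theorem IsDualExactSyzygy.stablyIso_of_linearEquiv (h : IsDualExactSyzygy R X Y)
    (h' : IsDualExactSyzygy R X' Y') (e : X ≃ₗ[R] X') : StablyIso R Y Y' := by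
  obtain ⟨P, i, p, _, _, hi, hp, h, hd⟩ := h
  obtain ⟨P', i', p', _, _, hi', hp', h', hd'⟩ := h'
  obtain ⟨s, hs⟩ := exists_extension_of_surjective_dualMap hd (i' ∘ₗ e.toLinearMap)
  obtain ⟨t, ht⟩ := exists_extension_of_surjective_dualMap hd' (i ∘ₗ e.symm.toLinearMap)
  have h (x) : p x = 0 ↔ ∃ y, i y = x := by
    rw [← LinearMap.mem_range, h, LinearMap.mem_ker]
  have h' (x) : p' x = 0 ↔ ∃ y, i' y = x := by
    rw [← LinearMap.mem_range, h', LinearMap.mem_ker]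
  refine ⟨P', P, ‹_›, ‹_›, ‹_›, ‹_›, nonempty_linearEquiv_of_ker_eq
    (f := (p ∘ₗ LinearMap.fst R P P').prod (s.coprod (-LinearMap.id)))
    (g := (p' ∘ₗ LinearMap.snd R P P').prod (LinearMap.id.coprod (-t))) ?_ ?_ ?_⟩
  · rintro ⟨y, z⟩
    obtain ⟨x, rfl⟩ := hp y
    exact ⟨(x, s x - z), by simp⟩
  · rintro ⟨y, z⟩
    obtain ⟨x, rfl⟩ := hp' y
    exact ⟨(z + t x, x), by simp⟩
  · ext ⟨x, y⟩
    have h1 : s x + -y = 0 ↔ s x = y := by rw [← sub_eq_add_neg, sub_eq_zero]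
    have h2 : x + -t y = 0 ↔ x = t y := by rw [← sub_eq_add_neg, sub_eq_zero]
    refine (Prod.mk_eq_zero (x := p x)).trans (.trans ?_ (Prod.mk_eq_zero (x := p' y)).symm)
    refine (and_congr (h x) h1).trans (.trans ?_ (and_congr (h' y) h2).symm)
    constructor
    · rintro ⟨⟨z, rfl⟩, rfl⟩
      exact ⟨⟨e z, (hs z).symm⟩, by rw [hs]; simp [ht]⟩
    · rintro ⟨⟨z, rfl⟩, rfl⟩
      exact ⟨⟨e.symm z, (ht z).symm⟩, by rw [ht]; simp [hs]⟩

theorem IsDualExactSyzygy.stablyIso (h : IsDualExactSyzygy R X Y)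
    (h' : IsDualExactSyzygy R X' Y') (e : StablyIso R X X') : StablyIso R Y Y' := by
  obtain ⟨P, Q, _, _, _, _, ⟨e⟩⟩ := e
  exact (h.prod_left P).stablyIso_of_linearEquiv (h'.prod_left Q) e

theorem IsSyzygy.injective_dual_eval (h : IsSyzygy R X Y) :
    Function.Injective (Module.Dual.eval R X) := by
  obtain ⟨P, i, p, _, _, hi, -⟩ := h
  refine (injective_iff_map_eq_zero _).2 fun x hx => hi ?_
  rw [map_zero]
  exact (Module.bijective_dual_eval R P).1 (by
    ext f
    simpa using LinearMap.congr_fun hx (f ∘ₗ i))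

theorem IsDualExactSyzygy.isReflexive (h : IsDualExactSyzygy R X Y)
    (hY : Function.Injective (Module.Dual.eval R Y)) : Module.IsReflexive R X := by
  refine ⟨h.isSyzygy.injective_dual_eval, fun φ => ?_⟩
  obtain ⟨P, i, p, _, _, hi, hp, h, hd⟩ := h
  obtain ⟨x, hx⟩ := (Module.bijective_dual_eval R P).2 (φ ∘ₗ i.dualMap)
  have hx (f : P →ₗ[R] R) : f x = φ (f ∘ₗ i) := LinearMap.congr_fun hx f
  have hpi (z) : p (i z) = 0 := by
    rw [← LinearMap.mem_ker, ← h]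
    exact ⟨z, rfl⟩
  have hpx : p x = 0 := hY (by
    ext f
    have : (f ∘ₗ p) ∘ₗ i = 0 := by ext z; simp [hpi]
    simpa [this] using hx (f ∘ₗ p))
  rw [← LinearMap.mem_ker, ← h] at hpx
  obtain ⟨z, rfl⟩ := hpx
  refine ⟨z, ?_⟩
  ext f
  obtain ⟨f, rfl⟩ := hd f
  exact hx f

variable (R) in
/-- There is a short exact sequence `0 → X → Y → Z → 0`. -/
def IsExtensionOf (X Y Z : Type) [AddCommGroup X] [Module R X] [AddCommGroup Y] [Module R Y]
    [AddCommGroup Z] [Module R Z] : Prop :=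
  ∃ (f : X →ₗ[R] Y) (g : Y →ₗ[R] Z), Function.Injective f ∧ Function.Surjective g ∧
    LinearMap.range f = LinearMap.ker g

/-- The horseshoe lemma. -/
theorem IsExtensionOf.exists_syzygy (h : IsExtensionOf R X Y Z) (hX : IsSyzygy R X' X)
    (hZ : IsSyzygy R Z' Z) :
    ∃ Y' : ModuleCat.{0} R, IsSyzygy R Y' Y ∧ IsExtensionOf R X' Y' Z' := by
  obtain ⟨f, g, hf, hg, h⟩ := h
  obtain ⟨P, i, p, _, _, hi, hp, hX⟩ := hX
  obtain ⟨Q, j, q, _, _, hj, hq, hZ⟩ := hZ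
  obtain ⟨s, hs⟩ := Module.projective_lifting_property g q hg
  have hs (x) : g (s x) = q x := LinearMap.congr_fun hs x
  have h (x) : g x = 0 ↔ ∃ y, f y = x := by
    rw [← LinearMap.mem_range, h, LinearMap.mem_ker]
  have hX (x) : p x = 0 ↔ ∃ y, i y = x := by
    rw [← LinearMap.mem_range, hX, LinearMap.mem_ker]
  have hqj (x) : q (j x) = 0 := by
    rw [← LinearMap.mem_ker, ← hZ]
    exact ⟨x, rfl⟩
  have hgf (x) : g (f x) = 0 := (h _).2 ⟨x, rfl⟩
  let π : P × Q →ₗ[R] Y := (f ∘ₗ p).coprod s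
  let e : Z' ≃ₗ[R] LinearMap.ker q := LinearEquiv.ofInjective j hj ≪≫ₗ LinearEquiv.ofEq _ _ hZ
  have hej (z) : (e z : Q) = j z := rfl
  let r : LinearMap.ker π →ₗ[R] LinearMap.ker q :=
    (LinearMap.snd R P Q).restrict fun x hx => by
      have := congr(g $(LinearMap.mem_ker.1 hx))
      simpa [π, hs, hgf] using this
  refine ⟨ModuleCat.of R (LinearMap.ker π), ⟨ModuleCat.of R (P × Q), (LinearMap.ker π).subtype, π,
    inferInstanceAs (Module.Free R (P × Q)), inferInstanceAs (Module.Finite R (P × Q)),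
    Subtype.val_injective, fun y => ?_, (LinearMap.ker π).range_subtype⟩,
    (LinearMap.inl R P Q ∘ₗ i).codRestrict _ fun x => ?_, e.symm.toLinearMap ∘ₗ r,
    fun x y hxy => ?_, e.symm.surjective.comp fun ⟨y, hy⟩ => ?_, ?_⟩
  · obtain ⟨z, hz⟩ := hq (g y)
    obtain ⟨x, hx⟩ := (h (y - s z)).1 (by simp [hs, hz])
    obtain ⟨x, rfl⟩ := hp x
    exact ⟨(x, z), by simp [π, hx]⟩
  · simp [π, (hX (i x)).2 ⟨x, rfl⟩]
  · exact hi (LinearMap.inl_injective (congr_arg Subtype.val hxy))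
  · obtain ⟨x, hx⟩ := (h (s y)).1 (by rw [hs]; exact hy)
    obtain ⟨x, rfl⟩ := hp x
    exact ⟨⟨(-x, y), by simp [π, hx]⟩, rfl⟩
  · ext ⟨⟨x, y⟩, hxy⟩
    have hxy : f (p x) + s y = 0 := hxy
    simp only [LinearMap.mem_range, LinearMap.mem_ker, LinearMap.comp_apply, LinearEquiv.coe_coe,
      LinearEquiv.map_eq_zero_iff]
    simp only [Subtype.ext_iff, r]
    constructor
    · rintro ⟨z, hz⟩
      exact congr_arg Prod.snd hz.symm
    · intro hy
      obtain rfl : y = 0 := hy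
      obtain ⟨z, rfl⟩ := (hX x).1 (hf (by simpa using hxy))
      exact ⟨z, rfl⟩

theorem IsExtensionOf.nonempty_linearEquiv [Subsingleton X] (h : IsExtensionOf R X Y Z) :
    Nonempty (Y ≃ₗ[R] Z) := by
  obtain ⟨f, g, hf, hg, h⟩ := h
  refine ⟨LinearEquiv.ofBijective g ⟨?_, hg⟩⟩
  rw [← LinearMap.ker_eq_bot, ← h, LinearMap.range_eq_bot]
  exact Subsingleton.elim _ _

theorem IsExtensionOf.exists_stablyIso {A B C : ℕ → ModuleCat.{0} R} {n : ℕ}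
    (hA : ∀ k < n, IsSyzygy R (A (k + 1)) (A k)) (hB : ∀ k < n, IsSyzygy R (B (k + 1)) (B k))
    (hC : ∀ k < n, IsSyzygy R (C (k + 1)) (C k)) (h : IsExtensionOf R (A 0) Y (C 0))
    (hY : StablyIso R Y (B 0)) :
    ∃ Y' : ModuleCat.{0} R, IsExtensionOf R (A n) Y' (C n) ∧ StablyIso R Y' (B n) := by
  induction n with
  | zero => exact ⟨ModuleCat.of R Y, h, hY⟩
  | succ n ih =>
    obtain ⟨Y', h1, h2⟩ := ih (fun k hk => hA k (by omega)) (fun k hk => hB k (by omega))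
      (fun k hk => hC k (by omega))
    obtain ⟨Y'', h3, h4⟩ := h1.exists_syzygy (hA n (by omega)) (hC n (by omega))
    exact ⟨Y'', h4, h3.stablyIso (hB n (by omega)) h2⟩

end StableModules

namespace MinFreeRes

variable {R : Type} [CommRing R] [IsLocalRing R] {M : Type} [AddCommGroup M] [Module R M]

/-- The surjection of the `n`-th free module of a resolution onto the `n`-th syzygy. -/
noncomputable def toSyz (C : MinFreeRes R M) : ∀ n, C.F n →ₗ[R] C.Syz n
  | 0 => C.aug
  | n + 1 => (C.d n).rangeRestrict

/-- The inclusion of the `n + 1`-st syzygy into the `n`-th free module of a resolution. -/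
noncomputable def syzInclusion (C : MinFreeRes R M) (n : ℕ) : C.Syz (n + 1) →ₗ[R] C.F n :=
  (LinearMap.range (C.d n)).subtype

theorem toSyz_surjective (C : MinFreeRes R M) : ∀ n, Function.Surjective (C.toSyz n)
  | 0 => C.aug_surj
  | n + 1 => (C.d n).surjective_rangeRestrict

theorem ker_toSyz (C : MinFreeRes R M) :
    ∀ n, LinearMap.ker (C.toSyz n) = LinearMap.range (C.d n)
  | 0 => C.exact_aug
  | n + 1 => (C.d n).ker_rangeRestrict.trans (C.exact n)

theorem syzInclusion_injective (C : MinFreeRes R M) (n : ℕ) :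
    Function.Injective (C.syzInclusion n) :=
  Subtype.val_injective

theorem range_syzInclusion (C : MinFreeRes R M) (n : ℕ) :
    LinearMap.range (C.syzInclusion n) = LinearMap.ker (C.toSyz n) :=
  (LinearMap.range (C.d n)).range_subtype.trans (C.ker_toSyz n).symm

theorem isSyzygy_syz (C : MinFreeRes R M) (n : ℕ) : IsSyzygy R (C.Syz (n + 1)) (C.Syz n) :=
  ⟨C.F n, C.syzInclusion n, C.toSyz n, C.free n, C.fin n, C.syzInclusion_injective n,
    C.toSyz_surjective n, C.range_syzInclusion n⟩

theorem nonempty_cocycles_linearEquiv (C : MinFreeRes R M) (n : ℕ) :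
    Nonempty (C.cocycles n ≃ₗ[R] Module.Dual R (C.Syz n)) := by
  refine ⟨.symm <| LinearEquiv.ofInjective (C.toSyz n).dualMap
    (LinearMap.dualMap_injective_of_surjective (C.toSyz_surjective n)) ≪≫ₗ LinearEquiv.ofEq _ _ ?_⟩
  rw [LinearMap.range_dualMap_eq_dualAnnihilator_ker_of_surjective _ (C.toSyz_surjective n),
    ker_toSyz]
  exact (LinearMap.ker_dualMap_eq_dualAnnihilator_range _).symm

theorem isDualExactSyzygy_syz (C : MinFreeRes R M) {n : ℕ}
    (h : C.cocycles (n + 1) ≤ C.coboundaries (n + 1)) :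
    IsDualExactSyzygy R (C.Syz (n + 1)) (C.Syz n) := by
  refine ⟨C.F n, C.syzInclusion n, C.toSyz n, C.free n, C.fin n, C.syzInclusion_injective n,
    C.toSyz_surjective n, C.range_syzInclusion n, fun f => ?_⟩
  have hf : f ∘ₗ C.toSyz (n + 1) ∈ C.cocycles (n + 1) := by
    ext x
    have : C.d (n + 1) x ∈ LinearMap.ker (C.toSyz (n + 1)) := by
      rw [ker_toSyz]
      exact ⟨x, rfl⟩
    exact (congr_arg f this).trans (map_zero f)
  obtain ⟨y, hy⟩ := h hf
  refine ⟨y, LinearMap.ext fun z => ?_⟩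
  obtain ⟨z, rfl⟩ := C.toSyz_surjective (n + 1) z
  exact LinearMap.congr_fun hy z

theorem isSyzygy_cocycles_coboundaries (C : MinFreeRes R M) (n : ℕ) :
    IsSyzygy R (C.cocycles n) (C.coboundaries (n + 1)) := by
  have := C.free n
  have := C.fin n
  exact ⟨ModuleCat.of R (Module.Dual R (C.F n)), (C.cocycles n).subtype,
    (C.d n).dualMap.rangeRestrict, inferInstanceAs (Module.Free R (Module.Dual R (C.F n))),
    inferInstanceAs (Module.Finite R (Module.Dual R (C.F n))), Subtype.val_injective,
    (C.d n).dualMap.surjective_rangeRestrict,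
    (Submodule.range_subtype _).trans (LinearMap.ker_rangeRestrict _).symm⟩

theorem isSyzygy_coboundaries_zero (C : MinFreeRes R M) :
    IsSyzygy R (C.coboundaries 0) (C.coboundaries 0) := by
  have : Subsingleton (C.coboundaries 0) := inferInstanceAs (Subsingleton (⊥ : Submodule R _))
  exact ⟨ModuleCat.of R PUnit, 0, 0, inferInstanceAs (Module.Free R PUnit),
    inferInstanceAs (Module.Finite R PUnit), Function.injective_of_subsingleton _,
    fun _ => ⟨0, Subsingleton.elim _ _⟩, by
      ext x
      exact ⟨fun _ => rfl, fun _ => ⟨0, rfl⟩⟩⟩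

theorem coboundaries_le_cocycles (C : MinFreeRes R M) : ∀ n, C.coboundaries n ≤ C.cocycles n
  | 0 => bot_le
  | n + 1 => by
    rintro _ ⟨f, rfl⟩
    ext x
    have : C.d (n + 1) x ∈ LinearMap.ker (C.d n) := by
      rw [C.exact]
      exact ⟨x, rfl⟩
    exact (congr_arg f this).trans (map_zero f)

theorem coboundaries_eq_cocycles (C : MinFreeRes R M) {n : ℕ}
    (h : Subsingleton (ExtMod R M R n)) : C.coboundaries n = C.cocycles n := by
  obtain ⟨q, -, hq⟩ := C.exists_cocycles_to_ext n
  exact (C.coboundaries_le_cocycles n).antisymm fun x hx => (hq ⟨x, hx⟩).1 (Subsingleton.elim _ _)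

theorem isExtensionOf_coboundaries_cocycles_ext (C : MinFreeRes R M) (n : ℕ) :
    IsExtensionOf R (C.coboundaries n) (C.cocycles n) (ExtMod R M R n) := by
  obtain ⟨q, hq, hq'⟩ := C.exists_cocycles_to_ext n
  refine ⟨Submodule.inclusion (C.coboundaries_le_cocycles n), q,
    Submodule.inclusion_injective _, hq, ?_⟩
  ext x
  rw [LinearMap.mem_ker, hq', Submodule.range_inclusion]
  rfl

theorem stablyIso_syz_add (C : MinFreeRes R M) {g a : ℕ}
    (hC : ∀ k, g < k → C.cocycles k ≤ C.coboundaries k) (hper : C.EventuallyPeriodic a) {k : ℕ}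
    (hk : g ≤ k) : StablyIso R (C.Syz k) (C.Syz (k + a)) := by
  obtain ⟨-, n, ⟨e⟩⟩ := hper
  have hn (k) (hk : n ≤ k) : StablyIso R (C.Syz k) (C.Syz (k + a)) := by
    induction k, hk using Nat.le_induction with
    | base => exact .of_linearEquiv e
    | succ k hk ih =>
      rw [Nat.add_right_comm]
      exact (C.isSyzygy_syz k).stablyIso (C.isSyzygy_syz (k + a)) ih
  obtain ⟨t, ht⟩ : ∃ t, n ≤ k + t := ⟨n, by omega⟩
  induction t generalizing k with
  | zero => exact hn k ht
  | succ t ih =>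
    have := ih (k := k + 1) (by omega) (by omega)
    rw [Nat.add_right_comm] at this
    exact (C.isDualExactSyzygy_syz (hC (k + 1) (by omega))).stablyIso
      (C.isDualExactSyzygy_syz (hC (k + a + 1) (by omega))) this

theorem stablyIso_syz_add_mul (C : MinFreeRes R M) {g a : ℕ}
    (hC : ∀ k, g < k → C.cocycles k ≤ C.coboundaries k) (hper : C.EventuallyPeriodic a) {k : ℕ}
    (hk : g ≤ k) (m : ℕ) : StablyIso R (C.Syz k) (C.Syz (k + m * a)) := by
  induction m with
  | zero => rw [Nat.zero_mul]; exact .of_linearEquiv (LinearEquiv.refl R _)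
  | succ m ih =>
    rw [Nat.succ_mul, ← Nat.add_assoc]
    exact ih.trans (C.stablyIso_syz_add hC hper (by omega))

theorem isReflexive_syz (C : MinFreeRes R M) {g a : ℕ}
    (hC : ∀ k, g < k → C.cocycles k ≤ C.coboundaries k) (hper : C.EventuallyPeriodic a) {k : ℕ}
    (hk : g ≤ k) : Module.IsReflexive R (C.Syz k) := by
  have ha := hper.1
  obtain ⟨j, hj⟩ : ∃ j, k + 2 * a = j + 2 := ⟨k + 2 * a - 2, by omega⟩
  have h := C.stablyIso_syz_add_mul hC hper hk 2
  rw [hj] at h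
  have := (C.isDualExactSyzygy_syz (hC (j + 1 + 1) (by omega))).isReflexive
    (C.isSyzygy_syz j).injective_dual_eval
  exact h.isReflexive

end MinFreeRes

theorem IsGPerfect.subsingleton_ext {R : Type} [CommRing R] {M : Type} [AddCommGroup M]
    [Module R M] (h : IsGPerfect R M) {n : ℕ} (hn : n ≠ mgrade R M) :
    Subsingleton (ExtMod R M R n) := by
  rcases hn.lt_or_gt with hn | hn
  · exact not_nontrivial_iff_subsingleton.1 (Nat.notMem_of_lt_sInf hn)
  · have hne : {n : ℕ∞ | ∃ m : ℕ, n = (m : ℕ∞) ∧ GdimLE R m (ModuleCat.of R M)}.Nonempty := by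
      by_contra! hempty
      have := h.2
      rw [Gdim, hempty, sInf_empty] at this
      exact ENat.top_ne_natCast _ this
    obtain ⟨m, hm, hG⟩ := csInf_mem hne
    obtain rfl : mgrade R M = m := by exact_mod_cast h.2.symm.trans hm
    exact subsingleton_ext_of_gdimLE _ (ModuleCat.of R M) hG n hn

/-- If `M` is G-perfect of grade `g` with eventually periodic minimal free resolution of
period `a > 0`, and `N = Ext^g_R(M,R)`, then `(Ωⁱ N)* ≈ Ω^{g+ma-i} M` for all
`i ≥ g` and `m ≥ i/a`. -/
theorem stmt_18 (R : Type) [CommRing R] [IsLocalRing R] [IsNoetherianRing R]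
    (M : Type) [AddCommGroup M] [Module R M] [Module.Finite R M]
    (g : ℕ) (hg : mgrade R M = g) (hGP : IsGPerfect R M)
    (C : MinFreeRes R M) (a : ℕ) (hper : C.EventuallyPeriodic a)
    (D : MinFreeRes R (ExtMod R M R g)) :
    ∀ i : ℕ, g ≤ i → ∀ m : ℕ, i ≤ m * a →
      StablyIso R (Module.Dual R (D.Syz i)) (C.Syz (g + m * a - i)) := by
  intro i hi m hm
  have hC (k : ℕ) (hk : k ≠ g) : C.coboundaries k = C.cocycles k :=
    C.coboundaries_eq_cocycles (hGP.subsingleton_ext (hg ▸ hk))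
  have hC' (k : ℕ) (hk : g < k) : C.cocycles k ≤ C.coboundaries k := (hC k (by omega)).ge
  have hA (k : ℕ) : IsSyzygy R (C.coboundaries (g - (k + 1))) (C.coboundaries (g - k)) := by
    rcases lt_or_ge k g with hk | hk
    · obtain ⟨l, hl⟩ : ∃ l, g - k = l + 1 := ⟨g - k - 1, by omega⟩
      rw [show g - (k + 1) = l by omega, hl, hC l (by omega)]
      exact C.isSyzygy_cocycles_coboundaries l
    · rw [Nat.sub_eq_zero_of_le hk, Nat.sub_eq_zero_of_le (by omega : g ≤ k + 1)]
      exact C.isSyzygy_coboundaries_zero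
  have hB (k : ℕ) (hk : k < i) :
      IsSyzygy R (C.cocycles (g + m * a - (k + 1))) (C.cocycles (g + m * a - k)) := by
    obtain ⟨l, hl⟩ : ∃ l, g + m * a - k = l + 1 := ⟨g + m * a - k - 1, by omega⟩
    rw [show g + m * a - (k + 1) = l by omega, hl, ← hC (l + 1) (by omega)]
    exact C.isSyzygy_cocycles_coboundaries l
  obtain ⟨e⟩ := C.nonempty_cocycles_linearEquiv g
  obtain ⟨e'⟩ := C.nonempty_cocycles_linearEquiv (g + m * a)
  obtain ⟨e''⟩ := C.nonempty_cocycles_linearEquiv (g + m * a - i)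
  obtain ⟨Y, hY, hYB⟩ := IsExtensionOf.exists_stablyIso (n := i)
    (A := fun j => ModuleCat.of R (C.coboundaries (g - j)))
    (B := fun j => ModuleCat.of R (C.cocycles (g + m * a - j))) (C := D.Syz)
    (fun k _ => hA k) hB (fun k _ => D.isSyzygy_syz k)
    (C.isExtensionOf_coboundaries_cocycles_ext g)
    ((StablyIso.of_linearEquiv e).trans
      ((C.stablyIso_syz_add_mul hC' hper le_rfl m).dual.trans (.of_linearEquiv e'.symm)))
  have : Subsingleton (ModuleCat.of R (C.coboundaries (g - i))) := by
    rw [Nat.sub_eq_zero_of_le hi]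
    exact inferInstanceAs (Subsingleton (⊥ : Submodule R _))
  obtain ⟨eY⟩ := hY.nonempty_linearEquiv
  have := C.isReflexive_syz hC' hper (k := g + m * a - i) (by omega)
  exact (((StablyIso.of_linearEquiv eY.symm).trans hYB).trans (.of_linearEquiv e'')).dual.trans
    (.of_linearEquiv (Module.evalEquiv R (C.Syz (g + m * a - i))).symm)
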